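/- Let X be a reflexive real Banach space, I ⊆ ℝ an interval, and k : X × I → ℝ a function such that k(x, ·) is concave on I for every x ∈ X, while k(·, λ) is continuous, coercive and sequentially weakly lower semicontinuous on X for every λ ∈ I. Assume moreover that sup_{λ ∈ I} inf_{x ∈ X} k(x, λ) < inf_{x ∈ X} sup_{λ ∈ I} k(x, λ). Then there exists an open interval A ⊆ I such that, for each λ ∈ A, the function x ↦ k(x, λ) has at least two local minima in X. -/

import Mathlib

open Filter Topology

/-- A sequence converges weakly in a real normed space iff every continuous
linear functional converges along it. -/
def WeaklyConvergent {X : Type*} [NormedAddCommGroup X] [NormedSpace ℝ X]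
    (u : ℕ → X) (x : X) : Prop :=
  ∀ f : X →L[ℝ] ℝ, Tendsto (fun n => f (u n)) atTop (𝓝 (f x))

/-- A functional is sequentially weakly lower semicontinuous if
`Φ x ≤ liminf Φ (u n)` (in the extended real sense) whenever `u n ⇀ x`. -/
def SeqWeaklyLSC {X : Type*} [NormedAddCommGroup X] [NormedSpace ℝ X]
    (Φ : X → ℝ) : Prop :=
  ∀ (u : ℕ → X) (x : X), WeaklyConvergent u x →
    (Φ x : EReal) ≤ liminf (fun n => ((Φ (u n) : EReal))) atTop

/-- A functional is coercive if `Φ x → +∞` as `‖x‖ → +∞`. -/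
def Coercive {X : Type*} [NormedAddCommGroup X] (Φ : X → ℝ) : Prop :=
  ∀ M : ℝ, ∃ R : ℝ, ∀ x : X, R ≤ ‖x‖ → M ≤ Φ x

open Set Bornology

section WeakCompactness

variable {X : Type*} [NormedAddCommGroup X] [NormedSpace ℝ X]

/-- A separable subspace of a normed space admits a sequence of continuous linear functionals
separating its points. -/
lemma exists_seq_dual_separating (Y : Submodule ℝ X)
    (hY : TopologicalSpace.IsSeparable (Y : Set X)) :
    ∃ g : ℕ → X →L[ℝ] ℝ, ∀ y ∈ Y, y ≠ 0 → ∃ n, g n y ≠ 0 := by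
  obtain ⟨t, ht, hYt⟩ := hY
  have hne : t.Nonempty := closure_nonempty_iff.1 ⟨0, hYt Y.zero_mem⟩
  obtain ⟨d, rfl⟩ := ht.exists_eq_range hne
  choose g hg1 hg2 using fun n => exists_dual_vector'' ℝ (d n)
  refine ⟨g, fun y hy hy0 => ?_⟩
  have hpos : 0 < ‖y‖ / 2 := half_pos (norm_pos_iff.2 hy0)
  obtain ⟨_, ⟨n, rfl⟩, hn⟩ := Metric.mem_closure_iff.1 (hYt hy) _ hpos
  refine ⟨n, fun h0 => ?_⟩
  rw [dist_eq_norm] at hn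
  have h1 : ‖g n (y - d n)‖ ≤ ‖y - d n‖ := (g n).le_of_opNorm_le (hg1 n) _ |>.trans (one_mul _).le
  rw [map_sub, h0, hg2 n] at h1
  simp only [RCLike.ofReal_real_eq_id, id_eq, zero_sub, norm_neg, norm_norm] at h1
  have h2 := norm_sub_norm_le y (d n)
  linarith

/-- In a reflexive space every bounded sequence has a weakly convergent subsequence. -/
lemma exists_weaklyConvergent_subseq
    (hrefl : Function.Surjective (NormedSpace.inclusionInDoubleDual ℝ X))
    {u : ℕ → X} {R : ℝ} (hu : ∀ n, ‖u n‖ ≤ R) :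
    ∃ (x : X) (φ : ℕ → ℕ), StrictMono φ ∧ WeaklyConvergent (u ∘ φ) x := by
  let Y : Submodule ℝ X := (Submodule.span ℝ (range u)).topologicalClosure
  have hY : TopologicalSpace.IsSeparable (Y : Set X) :=
    (countable_range u).isSeparable.span.closure
  obtain ⟨g, hg⟩ := exists_seq_dual_separating Y hY
  let S : Set X := Metric.closedBall 0 R ∩ Y
  have hSc : IsClosed S := Metric.isClosed_closedBall.inter (Submodule.isClosed_topologicalClosure _)
  have hSconv : Convex ℝ S := (convex_closedBall 0 R).inter Y.convex
  let K : Set (WeakSpace ℝ X) := toWeakSpace ℝ X '' S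
  have hK : IsCompact K := by
    have h : closure K = K := by
      rw [← hSconv.toWeakSpace_closure ℝ, hSc.closure_eq]
    rw [← h]
    refine NormedSpace.isCompact_closure_of_isBounded ℝ X K ?_ ?_
    · rw [preimage_image_eq _ (toWeakSpace ℝ X).injective]
      exact Metric.isBounded_closedBall.subset inter_subset_left
    · intro z _
      obtain ⟨x, hx⟩ := hrefl (WeakDual.toStrongDual z)
      refine ⟨toWeakSpace ℝ X x, ?_⟩
      exact DFunLike.ext _ _ fun f => DFunLike.congr_fun hx f
  have hcts : ∀ f : X →L[ℝ] ℝ, Continuous fun w : K => f ((toWeakSpace ℝ X).symm w) := fun f =>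
    (WeakBilin.eval_continuous (topDualPairing ℝ X).flip f).comp continuous_subtype_val
  have : CompactSpace K := isCompact_iff_compactSpace.1 hK
  have : TopologicalSpace.MetrizableSpace K := by
    refine Metric.PiNatEmbed.TopologicalSpace.MetrizableSpace.of_countable_separating
      (fun n (w : K) => g n ((toWeakSpace ℝ X).symm w)) (fun n => hcts (g n)) ?_
    rintro ⟨_, x, hx, rfl⟩ ⟨_, y, hy, rfl⟩ hxy
    obtain ⟨n, hn⟩ := hg (x - y) (Y.sub_mem hx.2 hy.2) (sub_ne_zero.2 fun h => hxy (by simp [h]))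
    exact ⟨n, by simpa [sub_eq_zero] using hn⟩
  have hmem : ∀ n, toWeakSpace ℝ X (u n) ∈ K := fun n => mem_image_of_mem _
    ⟨by simpa using hu n, Submodule.le_topologicalClosure _ (Submodule.subset_span ⟨n, rfl⟩)⟩
  obtain ⟨w, φ, hφ, hw⟩ := CompactSpace.tendsto_subseq fun n => (⟨_, hmem n⟩ : K)
  exact ⟨(toWeakSpace ℝ X).symm w, φ, hφ, fun f => ((hcts f).tendsto w).comp hw⟩

/-- A set containing the weak limits of all of its weakly convergent sequences. -/
def WeaklySeqClosed (C : Set X) : Prop :=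
  ∀ (u : ℕ → X) (x : X), (∀ n, u n ∈ C) → WeaklyConvergent u x → x ∈ C

lemma SeqWeaklyLSC.weaklySeqClosed_sublevel {Φ : X → ℝ} (hΦ : SeqWeaklyLSC Φ) (c : ℝ) :
    WeaklySeqClosed {x | Φ x ≤ c} := by
  intro u x hu hx
  have h : liminf (fun n => (Φ (u n) : EReal)) atTop ≤ liminf (fun _ : ℕ => (c : EReal)) atTop :=
    liminf_le_liminf (Eventually.of_forall fun n => EReal.coe_le_coe_iff.2 (hu n))
  rw [liminf_const] at h
  exact EReal.coe_le_coe_iff.1 ((hΦ u x hx).trans h)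

lemma weaklySeqClosed_setOf_forall_le {ι : Type*} {T : Set ι} {k : X → ι → ℝ}
    (hk : ∀ i ∈ T, SeqWeaklyLSC fun x => k x i) (c : ℝ) :
    WeaklySeqClosed {x | ∀ i ∈ T, k x i ≤ c} := fun u x hu hx i hi =>
  (hk i hi).weaklySeqClosed_sublevel c u x (fun n => hu n i hi) hx

lemma Coercive.isBounded_sublevel {X : Type*} [NormedAddCommGroup X] {Φ : X → ℝ} (hΦ : Coercive Φ) (c : ℝ) :
    IsBounded {x | Φ x ≤ c} := by
  obtain ⟨R, hR⟩ := hΦ (c + 1)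
  refine isBounded_iff_forall_norm_le.2 ⟨R, fun x hx => ?_⟩
  by_contra! h
  have h1 := hR x h.le
  have h2 : Φ x ≤ c := hx
  linarith

lemma SeqWeaklyLSC.exists_isMinOn
    (hrefl : Function.Surjective (NormedSpace.inclusionInDoubleDual ℝ X))
    {Φ : X → ℝ} (hΦ : SeqWeaklyLSC Φ) {C : Set X} (hC : WeaklySeqClosed C)
    (hb : IsBounded C) (hne : C.Nonempty) : ∃ x ∈ C, IsMinOn Φ C x := by
  obtain ⟨v, -, hv, hvC⟩ := exists_seq_tendsto_sInf (hne.image fun x => (Φ x : EReal))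
    (OrderBot.bddBelow _)
  choose u huC huv using hvC
  obtain ⟨R, hR⟩ := isBounded_iff_forall_norm_le.1 hb
  obtain ⟨x, φ, hφ, hx⟩ := exists_weaklyConvergent_subseq hrefl fun n => hR _ (huC n)
  refine ⟨x, hC _ x (fun n => huC (φ n)) hx, fun y hy => EReal.coe_le_coe_iff.1 ?_⟩
  have hlim : Tendsto (fun n => (Φ ((u ∘ φ) n) : EReal)) atTop
      (𝓝 (sInf ((fun x => (Φ x : EReal)) '' C))) := by
    simpa only [Function.comp_def, huv] using hv.comp hφ.tendsto_atTop
  have h := hΦ _ x hx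
  rw [hlim.liminf_eq] at h
  exact h.trans (sInf_le (mem_image_of_mem _ hy))

lemma nonempty_iInter_of_weaklySeqClosed
    (hrefl : Function.Surjective (NormedSpace.inclusionInDoubleDual ℝ X))
    {C : ℕ → Set X} (hanti : Antitone C) (hC : ∀ n, WeaklySeqClosed (C n))
    (hb : IsBounded (C 0)) (hne : ∀ n, (C n).Nonempty) : (⋂ n, C n).Nonempty := by
  choose u hu using hne
  obtain ⟨R, hR⟩ := isBounded_iff_forall_norm_le.1 hb
  obtain ⟨x, φ, hφ, hx⟩ :=
    exists_weaklyConvergent_subseq hrefl fun n => hR _ (hanti (Nat.zero_le n) (hu n))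
  refine ⟨x, mem_iInter.2 fun m => hC m (fun n => u (φ (n + m))) x (fun n => ?_) fun f => ?_⟩
  · exact hanti ((Nat.le_add_left m n).trans (hφ.id_le _)) (hu _)
  · exact (hx f).comp (tendsto_add_atTop_nat m)

/-- If a sublevel set splits into two disjoint nonempty pieces that are closed in norm and
sequentially weakly closed, then each piece contains a local minimum. -/
lemma SeqWeaklyLSC.exists_two_isLocalMin
    (hrefl : Function.Surjective (NormedSpace.inclusionInDoubleDual ℝ X))
    {Φ : X → ℝ} (hΦ : SeqWeaklyLSC Φ) (hcoer : Coercive Φ) {c : ℝ} {C D : Set X}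
    (hCD : C ∪ D = {x | Φ x ≤ c}) (hdisj : Disjoint C D)
    (hC : WeaklySeqClosed C) (hD : WeaklySeqClosed D) (hC' : IsClosed C) (hD' : IsClosed D)
    (hCne : C.Nonempty) (hDne : D.Nonempty) :
    ∃ x₁ x₂ : X, x₁ ≠ x₂ ∧ IsLocalMin Φ x₁ ∧ IsLocalMin Φ x₂ := by
  have key : ∀ {A B : Set X}, A ∪ B = {x | Φ x ≤ c} → Disjoint A B → IsClosed B →
      ∀ x ∈ A, IsMinOn Φ A x → IsLocalMin Φ x := by
    intro A B hAB hdis hB x hxA hmin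
    filter_upwards [hB.isOpen_compl.mem_nhds (disjoint_left.1 hdis hxA)] with y hy
    by_cases hyA : y ∈ A
    · exact hmin hyA
    · have hx : Φ x ≤ c := hAB.subset (Or.inl hxA)
      have hyc : ¬ Φ y ≤ c := fun h => (hAB.superset h).elim hyA hy
      linarith
  have hb : IsBounded (C ∪ D) := hCD ▸ hcoer.isBounded_sublevel c
  obtain ⟨x, hxC, hx⟩ := hΦ.exists_isMinOn hrefl hC (hb.subset subset_union_left) hCne
  obtain ⟨y, hyD, hy⟩ := hΦ.exists_isMinOn hrefl hD (hb.subset subset_union_right) hDne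
  exact ⟨x, y, fun h => disjoint_left.1 hdisj hxC (h ▸ hyD), key hCD hdisj hD' x hxC hx,
    key (union_comm C D ▸ hCD) hdisj.symm hC' y hyD hy⟩

end WeakCompactness

section Minimax

variable {X : Type*} [NormedAddCommGroup X] [NormedSpace ℝ X]

/-- If `c < sup_{i ∈ J} k(x, i)` for all `x` and `J` is the increasing union of the sets `T n`,
then `c < sup_{i ∈ T n} k(x, i)` for all `x`, for some `n`. -/
lemma exists_forall_exists_lt_of_iUnion_eq
    (hrefl : Function.Surjective (NormedSpace.inclusionInDoubleDual ℝ X))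
    {ι : Type*} {J : Set ι} {k : X → ι → ℝ} {c : ℝ}
    (hcoer : ∀ i ∈ J, Coercive fun x => k x i) (hlsc : ∀ i ∈ J, SeqWeaklyLSC fun x => k x i)
    (hsup : ∀ x, ∃ i ∈ J, c < k x i) {T : ℕ → Set ι} (hT : Monotone T) (hTJ : ⋃ n, T n = J)
    (hT0 : (T 0).Nonempty) : ∃ n, ∀ x, ∃ i ∈ T n, c < k x i := by
  by_contra! h
  have hsub : ∀ n, T n ⊆ J := fun n => hTJ ▸ subset_iUnion T n
  obtain ⟨i, hi⟩ := hT0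
  obtain ⟨x, hx⟩ := nonempty_iInter_of_weaklySeqClosed hrefl
    (C := fun n => {x | ∀ i ∈ T n, k x i ≤ c})
    (fun m n hmn x hx i hi => hx i (hT hmn hi))
    (fun n => weaklySeqClosed_setOf_forall_le (fun i hi => hlsc i (hsub n hi)) c)
    (((hcoer i (hsub 0 hi)).isBounded_sublevel c).subset fun x hx => hx i hi) h
  obtain ⟨j, hj, hlt⟩ := hsup x
  obtain ⟨n, hn⟩ := mem_iUnion.1 (hTJ.superset hj)
  exact (mem_iInter.1 hx n j hn).not_gt hlt

/-- Minimax alternative on an open interval `J`. -/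
lemma exists_isOpen_two_isLocalMin
    (hrefl : Function.Surjective (NormedSpace.inclusionInDoubleDual ℝ X))
    {J : Set ℝ} (hJo : IsOpen J) (hJne : J.Nonempty) {k : X → ℝ → ℝ} {c : ℝ}
    (hconc : ∀ x, ConcaveOn ℝ J (k x)) (hcont : ∀ t ∈ J, Continuous fun x => k x t)
    (hcoer : ∀ t ∈ J, Coercive fun x => k x t) (hlsc : ∀ t ∈ J, SeqWeaklyLSC fun x => k x t)
    (hinf : ∀ t ∈ J, ∃ x, k x t < c) (hsup : ∀ x, ∃ t ∈ J, c < k x t) :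
    ∃ A : Set ℝ, IsOpen A ∧ Convex ℝ A ∧ A.Nonempty ∧ A ⊆ J ∧
      ∀ t ∈ A, ∃ x₁ x₂ : X, x₁ ≠ x₂ ∧
        IsLocalMin (fun x => k x t) x₁ ∧ IsLocalMin (fun x => k x t) x₂ := by
  obtain ⟨x₀, -⟩ := hinf _ hJne.some_mem
  have hJc : OrdConnected J := (hconc x₀).1.ordConnected
  have hconv : ∀ {x s t r}, s ∈ J → r ∈ J → s ≤ t → t ≤ r → c < k x s → c < k x r → c < k x t :=
    fun {x s t r} hs hr hst htr h1 h2 =>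
      (lt_min h1 h2).trans_le ((hconc x).min_le_of_mem_Icc hs hr ⟨hst, htr⟩)
  let P : Set ℝ := {t | ∃ x, ∀ s ∈ J ∩ Iic t, k x s ≤ c}
  let Q : Set ℝ := {t | ∃ x, ∀ s ∈ J ∩ Ici t, k x s ≤ c}
  have hP : ∀ {s t}, s ≤ t → t ∈ P → s ∈ P := fun hst ⟨x, hx⟩ =>
    ⟨x, fun r hr => hx r ⟨hr.1, hr.2.trans hst⟩⟩
  have hQ : ∀ {s t}, s ≤ t → s ∈ Q → t ∈ Q := fun hst ⟨x, hx⟩ =>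
    ⟨x, fun r hr => hx r ⟨hr.1, hst.trans hr.2⟩⟩
  have hsplit : ∀ {t x}, t ∈ J → k x t ≤ c →
      (∀ s ∈ J ∩ Iic t, k x s ≤ c) ∨ ∀ s ∈ J ∩ Ici t, k x s ≤ c := by
    intro t x ht hx
    by_contra! h
    obtain ⟨⟨s, hs, hs'⟩, r, hr, hr'⟩ := h
    exact (hconv hs.1 hr.1 hs.2 hr.2 hs' hr').not_ge hx
  have hPQ : ∀ t ∈ J, t ∈ P ∨ t ∈ Q := fun t ht => by
    obtain ⟨x, hx⟩ := hinf t ht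
    exact (hsplit ht hx.le).imp (fun h => ⟨x, h⟩) fun h => ⟨x, h⟩
  have htwo : ∀ t ∈ J, t ∈ P → t ∈ Q → ∃ x₁ x₂ : X, x₁ ≠ x₂ ∧
      IsLocalMin (fun x => k x t) x₁ ∧ IsLocalMin (fun x => k x t) x₂ := by
    intro t ht htP htQ
    have hclosed : ∀ T ⊆ J, IsClosed {x | ∀ s ∈ T, k x s ≤ c} := fun T hT => by
      have h : {x | ∀ s ∈ T, k x s ≤ c} = ⋂ s ∈ T, {x | k x s ≤ c} := by ext; simp
      rw [h]
      exact isClosed_biInter fun s hs => isClosed_le (hcont s (hT hs)) continuous_const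
    refine (hlsc t ht).exists_two_isLocalMin hrefl (hcoer t ht) (c := c)
      (C := {x | ∀ s ∈ J ∩ Iic t, k x s ≤ c}) (D := {x | ∀ s ∈ J ∩ Ici t, k x s ≤ c}) ?_ ?_
      (weaklySeqClosed_setOf_forall_le (fun s hs => hlsc s hs.1) c)
      (weaklySeqClosed_setOf_forall_le (fun s hs => hlsc s hs.1) c)
      (hclosed _ inter_subset_left) (hclosed _ inter_subset_left) htP htQ
    · ext x
      exact ⟨fun h => h.elim (fun h => h t ⟨ht, self_mem_Iic⟩) fun h => h t ⟨ht, self_mem_Ici⟩, hsplit ht⟩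
    · refine disjoint_left.2 fun x hx hx' => ?_
      obtain ⟨s, hs, hlt⟩ := hsup x
      exact ((le_total s t).elim (fun h => hx s ⟨hs, h⟩) fun h => hx' s ⟨hs, h⟩).not_gt hlt
  have hne : Nonempty J := hJne.to_subtype
  obtain ⟨a, ha, haQ⟩ : ∃ a ∈ J, a ∉ Q := by
    obtain ⟨a, ha, ha'⟩ := exists_seq_antitone_tendsto_atTop_atBot J
    obtain ⟨n, hn⟩ := exists_forall_exists_lt_of_iUnion_eq hrefl hcoer hlsc hsup
      (T := fun n => J ∩ Ici (a n : ℝ))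
      (fun m n hmn s hs => ⟨hs.1, Ici_subset_Ici.2 (Subtype.coe_le_coe.2 (ha hmn)) hs.2⟩)
      (subset_antisymm (iUnion_subset fun n => inter_subset_left) fun s hs => by
        obtain ⟨n, hn⟩ := (ha'.eventually_le_atBot (⟨s, hs⟩ : J)).exists
        exact mem_iUnion.2 ⟨n, hs, hn⟩)
      ⟨a 0, (a 0).2, self_mem_Ici⟩
    refine ⟨a n, (a n).2, fun ⟨x, hx⟩ => ?_⟩
    obtain ⟨s, hs, hlt⟩ := hn x
    exact (hx s hs).not_gt hlt
  obtain ⟨b, hb, hbP⟩ : ∃ b ∈ J, b ∉ P := by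
    obtain ⟨b, hb, hb'⟩ := exists_seq_monotone_tendsto_atTop_atTop J
    obtain ⟨n, hn⟩ := exists_forall_exists_lt_of_iUnion_eq hrefl hcoer hlsc hsup
      (T := fun n => J ∩ Iic (b n : ℝ))
      (fun m n hmn s hs => ⟨hs.1, Iic_subset_Iic.2 (Subtype.coe_le_coe.2 (hb hmn)) hs.2⟩)
      (subset_antisymm (iUnion_subset fun n => inter_subset_left) fun s hs => by
        obtain ⟨n, hn⟩ := (hb'.eventually_ge_atTop (⟨s, hs⟩ : J)).exists
        exact mem_iUnion.2 ⟨n, hs, hn⟩)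
      ⟨b 0, (b 0).2, self_mem_Iic⟩
    refine ⟨b n, (b n).2, fun ⟨x, hx⟩ => ?_⟩
    obtain ⟨s, hs, hlt⟩ := hn x
    exact (hx s hs).not_gt hlt
  have haP : a ∈ P := (hPQ a ha).resolve_right haQ
  have hPb : b ∈ upperBounds P := fun t ht => not_lt.1 fun h => hbP (hP h.le ht)
  have hlub : IsLUB P (sSup P) := isLUB_csSup ⟨a, haP⟩ ⟨b, hPb⟩
  set m := sSup P
  have hm : m ∈ J := hJc.out ha hb ⟨hlub.1 haP, hlub.2 hPb⟩
  obtain ⟨x, hx⟩ := hinf m hm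
  obtain ⟨ε, hε, hball⟩ := Metric.mem_nhds_iff.1 <| inter_mem (hJo.mem_nhds hm) <|
    (((hconc x).continuousOn hJo).continuousAt (hJo.mem_nhds hm)).eventually_lt_const hx
  rw [Real.ball_eq_Ioo] at hball
  have hcase : m - ε / 2 ∈ Q := by
    have h1 := hball (show m + ε / 2 ∈ Ioo (m - ε) (m + ε) by constructor <;> linarith)
    have h2 := hball (show m - ε / 2 ∈ Ioo (m - ε) (m + ε) by constructor <;> linarith)
    rcases hsplit h1.1 (le_of_lt h1.2) with h | h
    · have := hlub.1 (show m + ε / 2 ∈ P from ⟨x, h⟩)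
      linarith
    rcases hsplit h2.1 (le_of_lt h2.2) with h' | h'
    · obtain ⟨s, hs, hlt⟩ := hsup x
      exfalso
      rcases le_total s (m - ε / 2) with hs1 | hs1
      · exact (h' s ⟨hs, hs1⟩).not_gt hlt
      rcases le_total (m + ε / 2) s with hs2 | hs2
      · exact (h s ⟨hs, hs2⟩).not_gt hlt
      · have h3 : k x s < c := (hball (show s ∈ Ioo _ _ by constructor <;> linarith)).2
        exact h3.not_gt hlt
    · exact ⟨x, h'⟩
  have hsub : Ioo (m - ε / 2) m ⊆ J := fun t ht =>
    (hball ⟨by linarith [ht.1], by linarith [ht.2]⟩).1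
  refine ⟨Ioo (m - ε / 2) m, isOpen_Ioo, convex_Ioo _ _, nonempty_Ioo.2 (by linarith), hsub,
    fun t ht => htwo t (hsub ht) ?_ (hQ ht.1.le hcase)⟩
  obtain ⟨p, hp, htp⟩ := (lt_isLUB_iff hlub).1 ht.2
  exact hP htp.le hp

end Minimax

/-- A concave function exceeding `c` somewhere on `I` exceeds `c` somewhere in the interior. -/
lemma ConcaveOn.exists_mem_interior_lt {I : Set ℝ} {f : ℝ → ℝ} (hf : ConcaveOn ℝ I f)
    (hI : (interior I).Nonempty) {c t : ℝ} (ht : t ∈ I) (hc : c < f t) :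
    ∃ s ∈ interior I, c < f s := by
  obtain ⟨r, hr⟩ := hI
  have hlim : Tendsto (fun a : ℝ => (1 - a) * f t + a * f r) (𝓝[>] 0) (𝓝 (f t)) := by
    have h : Continuous fun a : ℝ => (1 - a) * f t + a * f r := by fun_prop
    simpa using (h.tendsto 0).mono_left nhdsWithin_le_nhds
  obtain ⟨a, hca, ha0, ha1⟩ :=
    ((hlim.eventually_const_lt hc).and (Ioo_mem_nhdsGT zero_lt_one)).exists
  refine ⟨(1 - a) • t + a • r, hf.1.combo_self_interior_mem_interior ht hr (by linarith) ha0
    (by ring), hca.trans_le ?_⟩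
  exact hf.2 ht (interior_subset hr) (by linarith) ha0.le (by ring)

/-- **Ricceri's three critical points theorem, minimax form** ([2], Theorem B).
Let `X` be a reflexive real Banach space, `I ⊆ ℝ` an interval (i.e. a convex
set of reals) and `k : X × I → ℝ` a function such that `k(x, ·)` is concave on
`I` for all `x ∈ X`, while `k(·, λ)` is continuous, coercive and sequentially
weakly lower semicontinuous on `X` for all `λ ∈ I`.  If moreover
`sup_{λ ∈ I} inf_X k(·, λ) < inf_X sup_{λ ∈ I} k(·, λ)`, then there exists an
open interval `A ⊆ I` such that for each `λ ∈ A` the function `k(·, λ)` has at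
least two local minima. -/
theorem ricceri_two_local_minima
    {X : Type*} [NormedAddCommGroup X] [NormedSpace ℝ X] [CompleteSpace X]
    (hrefl : Function.Surjective (NormedSpace.inclusionInDoubleDual ℝ X))
    (I : Set ℝ) (hI : Convex ℝ I)
    (k : X → ℝ → ℝ)
    (hconc : ∀ x : X, ConcaveOn ℝ I (k x))
    (hcont : ∀ lam ∈ I, Continuous (fun x : X => k x lam))
    (hcoer : ∀ lam ∈ I, Coercive (fun x : X => k x lam))
    (hlsc : ∀ lam ∈ I, SeqWeaklyLSC (fun x : X => k x lam))
    (hminimax : (⨆ lam ∈ I, ⨅ x : X, ((k x lam : ℝ) : EReal)) <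
      ⨅ x : X, ⨆ lam ∈ I, ((k x lam : ℝ) : EReal)) :
    ∃ A : Set ℝ, IsOpen A ∧ Convex ℝ A ∧ A.Nonempty ∧ A ⊆ I ∧
      ∀ lam ∈ A, ∃ x₁ x₂ : X, x₁ ≠ x₂ ∧
        IsLocalMin (fun x : X => k x lam) x₁ ∧
        IsLocalMin (fun x : X => k x lam) x₂ := by
  obtain ⟨c, hc1, hc2⟩ := EReal.lt_iff_exists_real_btwn.1 hminimax
  have hinf : ∀ t ∈ I, ∃ x, k x t < c := fun t ht => by
    have h := (le_iSup₂ (f := fun t (_ : t ∈ I) => ⨅ x : X, (k x t : EReal)) t ht).trans_lt hc1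
    obtain ⟨x, hx⟩ := iInf_lt_iff.1 h
    exact ⟨x, EReal.coe_lt_coe_iff.1 hx⟩
  have hsup : ∀ x, ∃ t ∈ I, c < k x t := fun x => by
    obtain ⟨t, h⟩ := lt_iSup_iff.1 (hc2.trans_le (iInf_le _ x))
    obtain ⟨ht, h⟩ := lt_iSup_iff.1 h
    exact ⟨t, ht, EReal.coe_lt_coe_iff.1 h⟩
  have hint : (interior I).Nonempty := by
    obtain ⟨t, ht, -⟩ := hsup 0
    obtain ⟨x, hx⟩ := hinf t ht
    obtain ⟨s, hs, hxs⟩ := hsup x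
    have hne : t ≠ s := by
      rintro rfl
      exact hx.not_gt hxs
    refine (nonempty_Ioo.2 (min_lt_max.2 hne)).mono (interior_maximal ?_ isOpen_Ioo)
    exact Ioo_subset_Icc_self.trans (hI.ordConnected.uIcc_subset ht hs)
  obtain ⟨A, hAo, hAc, hAne, hAI, hA⟩ := exists_isOpen_two_isLocalMin hrefl isOpen_interior hint
    (fun x => (hconc x).subset interior_subset hI.interior)
    (fun t ht => hcont t (interior_subset ht)) (fun t ht => hcoer t (interior_subset ht))
    (fun t ht => hlsc t (interior_subset ht)) (fun t ht => hinf t (interior_subset ht))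
    fun x => by
      obtain ⟨t, ht, h⟩ := hsup x
      exact (hconc x).exists_mem_interior_lt hint ht h
  exact ⟨A, hAo, hAc, hAne, hAI.trans interior_subset, hA⟩
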